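/- arXiv:2601.07350 — 3 statements merged into one kernel-verified Lean document; each statement's English description precedes it below -/
import Mathlib

section
/- It holds that ∫∫_{ℝ²} (u² + v²) · exp(−(u² + v²)/4) · (log(u²) + log(v²)) du dv = 32π·(1 − γ), where γ is the Euler–Mascheroni constant. -/
open Real MeasureTheory

section GaussianLog

open Set Filter Asymptotics Topology

/-- The integral formula for the derivative of the real Gamma function, together with the
integrability of its integrand. -/
lemma integrableOn_and_hasDerivAt_Gamma {s : ℝ} (hs : 0 < s) :
    IntegrableOn (fun t : ℝ => t ^ (s - 1) * (log t * exp (-t))) (Ioi 0) ∧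
      HasDerivAt Gamma (∫ t in Ioi (0 : ℝ), t ^ (s - 1) * (log t * exp (-t))) s := by
  have hs' : 0 < (s : ℂ).re := by simpa using hs
  have hcongr : ∀ t ∈ Ioi (0 : ℝ), (t : ℂ) ^ ((s : ℂ) - 1) * (Real.log t * Real.exp (-t)) =
      ((t ^ (s - 1) * (log t * exp (-t)) : ℝ) : ℂ) := by
    intro t ht
    rw [Complex.ofReal_mul, Complex.ofReal_cpow (le_of_lt ht)]
    push_cast
    rfl
  constructor
  · have hc : Continuous fun t : ℝ => (Real.exp (-t) : ℂ) := by fun_prop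
    have h := (mellin_hasDerivAt_of_isBigO_rpow (E := ℂ) (f := fun t : ℝ => (Real.exp (-t) : ℂ))
      (a := s + 1) (b := 0) (s := s) (hc.continuousOn.locallyIntegrableOn measurableSet_Ioi)
      ?_ (by simp) ?_ hs').1
    · have h' : IntegrableOn (fun t : ℝ => ((t ^ (s - 1) * (log t * exp (-t)) : ℝ) : ℂ))
          (Ioi 0) := by
        refine IntegrableOn.congr_fun h (fun t ht => ?_) measurableSet_Ioi
        rw [← hcongr t ht]
        simp
      exact Integrable.re h'
    · rw [← isBigO_norm_left]
      simp_rw [Complex.norm_real, isBigO_norm_left]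
      simpa only [neg_one_mul] using (isLittleO_exp_neg_mul_rpow_atTop zero_lt_one _).isBigO
    · simp_rw [neg_zero, rpow_zero]
      exact (hc.tendsto 0).mono_left nhdsWithin_le_nhds |>.isBigO_one ℝ
  · have h := Complex.hasDerivAt_GammaIntegral hs'
    rw [setIntegral_congr_fun measurableSet_Ioi hcongr, integral_complex_ofReal] at h
    have hG : HasDerivAt Complex.Gamma _ (s : ℂ) := h.congr_of_eventuallyEq <| by
      filter_upwards [(isOpen_lt continuous_const Complex.continuous_re).mem_nhds hs'] with z hz
      exact Complex.Gamma_eq_integral hz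
    exact hG.real_of_complex

lemma integrable_comp_abs {f : ℝ → ℝ} (hf : IntegrableOn f (Ioi 0)) :
    Integrable fun x => f |x| := by
  have h : IntegrableOn (fun x => f |x|) (Ioi 0) :=
    hf.congr_fun (fun x hx => by rw [abs_of_pos hx]) measurableSet_Ioi
  have h' : IntegrableOn (fun x => f |x|) (Iic 0) := by
    rw [integrableOn_Iic_iff_integrableOn_Iio]
    simpa using h.comp_neg
  rw [← integrableOn_univ, ← Iic_union_Ioi (a := (0 : ℝ))]
  exact h'.union h

lemma integrable_abs_mul_comp_sq_div_four {f : ℝ → ℝ} (hf : IntegrableOn f (Ioi 0)) :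
    Integrable fun u : ℝ => |u| * f (u ^ 2 / 4) := by
  have h := (integrableOn_Ioi_comp_rpow_iff' (fun y => f (y * (1 / 4))) two_ne_zero).2
    ((integrableOn_Ioi_comp_mul_right_iff f 0 (by norm_num : (0 : ℝ) < 1 / 4)).2
      (by simpa using hf))
  refine (integrable_comp_abs h).congr (.of_forall fun u => ?_)
  norm_num [div_eq_mul_inv]

lemma integral_abs_mul_comp_sq_div_four (f : ℝ → ℝ) :
    ∫ u : ℝ, |u| * f (u ^ 2 / 4) = 4 * ∫ t in Ioi (0 : ℝ), f t := by
  have h := integral_comp_rpow_Ioi_of_pos (g := fun y => f (y * (1 / 4))) two_pos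
  rw [integral_comp_mul_right_Ioi f 0 (by norm_num : (0 : ℝ) < 1 / 4)] at h
  calc ∫ u : ℝ, |u| * f (u ^ 2 / 4)
      = ∫ u : ℝ, (fun x : ℝ => x * f (x ^ 2 / 4)) |u| := by simp
    _ = ∫ x in Ioi (0 : ℝ), (2 * x ^ (2 - 1 : ℝ)) • f (x ^ (2 : ℝ) * (1 / 4)) := by
      rw [integral_comp_abs (f := fun x => x * f (x ^ 2 / 4)), ← integral_const_mul]
      refine setIntegral_congr_fun measurableSet_Ioi fun x _ => ?_
      norm_num [div_eq_mul_inv]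
      ring
    _ = 4 * ∫ t in Ioi (0 : ℝ), f t := by
      rw [h]
      norm_num

lemma abs_mul_sq_div_four_rpow_neg_half {u : ℝ} (hu : u ≠ 0) :
    |u| * (u ^ 2 / 4) ^ (1 / 2 - 1 : ℝ) = 2 := by
  have h : u ^ 2 / 4 = (|u| / 2) ^ 2 := by rw [div_pow, sq_abs]; norm_num
  have hu' := abs_pos.2 hu
  rw [show (1 / 2 - 1 : ℝ) = -(1 / 2) by norm_num, rpow_neg (by positivity), ← sqrt_eq_rpow, h,
    sqrt_sq (by positivity)]
  field_simp

lemma abs_mul_sq_div_four_rpow_half (u : ℝ) :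
    |u| * (u ^ 2 / 4) ^ (3 / 2 - 1 : ℝ) = u ^ 2 / 2 := by
  have h : u ^ 2 / 4 = (|u| / 2) ^ 2 := by rw [div_pow, sq_abs]; norm_num
  rw [show (3 / 2 - 1 : ℝ) = 1 / 2 by norm_num, ← sqrt_eq_rpow, h, sqrt_sq (by positivity),
    ← sq_abs u]
  ring

lemma log_sq_eq_log_sq_div_four_add {u : ℝ} (hu : u ≠ 0) :
    log (u ^ 2) = log (u ^ 2 / 4) + 2 * log 2 := by
  rw [log_div (by positivity) (by norm_num), show (4 : ℝ) = 2 ^ 2 by norm_num, log_pow 2 2]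
  push_cast
  ring

lemma Gamma_three_half : Gamma (3 / 2) = √π / 2 := by
  rw [show (3 / 2 : ℝ) = 1 / 2 + 1 by norm_num, Gamma_add_one (by norm_num), Gamma_one_half_eq]
  ring

lemma hasDerivAt_Gamma_three_half :
    HasDerivAt Gamma (√π * (1 - eulerMascheroniConstant / 2 - log 2)) (3 / 2) := by
  have h : HasDerivAt (fun s => (s - 1) * Gamma (s - 1))
      (1 * Gamma (3 / 2 - 1) + (3 / 2 - 1) * (-√π * (eulerMascheroniConstant + 2 * log 2)))
      (3 / 2) := by
    refine ((hasDerivAt_id (3 / 2 : ℝ)).sub_const 1).mul ?_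
    refine HasDerivAt.comp_sub_const (3 / 2 : ℝ) 1 ?_
    rw [show (3 / 2 - 1 : ℝ) = 1 / 2 by norm_num]
    exact hasDerivAt_Gamma_one_half
  rw [show (3 / 2 - 1 : ℝ) = 1 / 2 by norm_num, Gamma_one_half_eq] at h
  refine (h.congr_of_eventuallyEq ?_).congr_deriv (by ring)
  filter_upwards [eventually_gt_nhds (by norm_num : (1 : ℝ) < 3 / 2)] with s hs
  rw [← Gamma_add_one (by linarith), sub_add_cancel]

lemma integrableOn_rpow_mul_exp_neg_mul_log_add {s : ℝ} (hs : 0 < s) (c : ℝ) :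
    IntegrableOn (fun t : ℝ => t ^ (s - 1) * (exp (-t) * (log t + c))) (Ioi 0) := by
  refine ((integrableOn_and_hasDerivAt_Gamma hs).1.add
    ((GammaIntegral_convergent hs).const_mul c)).congr (.of_forall fun t => ?_)
  simp only [Pi.add_apply]
  ring

lemma integral_rpow_mul_exp_neg_mul_log_add {s : ℝ} (hs : 0 < s) (c : ℝ) :
    ∫ t in Ioi (0 : ℝ), t ^ (s - 1) * (exp (-t) * (log t + c)) = deriv Gamma s + c * Gamma s := by
  obtain ⟨hi, hd⟩ := integrableOn_and_hasDerivAt_Gamma hs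
  rw [hd.deriv, Gamma_eq_integral hs, ← integral_const_mul,
    ← integral_add hi ((GammaIntegral_convergent hs).const_mul c)]
  congr 1 with t
  ring

lemma integrable_exp_neg_sq_div_four : Integrable fun u : ℝ => exp (-u ^ 2 / 4) := by
  refine (integrable_exp_neg_mul_sq (b := 1 / 4) (by norm_num)).congr (.of_forall fun u => ?_)
  ring_nf

lemma integral_exp_neg_sq_div_four : ∫ u : ℝ, exp (-u ^ 2 / 4) = 2 * √π := by
  calc ∫ u : ℝ, exp (-u ^ 2 / 4) = ∫ u : ℝ, exp (-(1 / 4) * u ^ 2) := by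
        congr 1 with u
        ring_nf
    _ = √(2 ^ 2 * π) := by rw [integral_gaussian]; ring_nf
    _ = 2 * √π := by rw [sqrt_mul (by norm_num), sqrt_sq zero_le_two]

lemma sq_mul_exp_neg_sq_div_four_eq (u : ℝ) :
    u ^ 2 * exp (-u ^ 2 / 4) =
      2 * (|u| * (exp (-(u ^ 2 / 4)) * (u ^ 2 / 4) ^ (3 / 2 - 1 : ℝ))) := by
  rw [mul_left_comm |u|, abs_mul_sq_div_four_rpow_half, neg_div]
  ring

lemma integrable_sq_mul_exp_neg_sq_div_four :
    Integrable fun u : ℝ => u ^ 2 * exp (-u ^ 2 / 4) := by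
  simp_rw [sq_mul_exp_neg_sq_div_four_eq]
  exact (integrable_abs_mul_comp_sq_div_four
    (GammaIntegral_convergent (by norm_num : (0 : ℝ) < 3 / 2))).const_mul 2

lemma integral_sq_mul_exp_neg_sq_div_four :
    ∫ u : ℝ, u ^ 2 * exp (-u ^ 2 / 4) = 4 * √π := by
  simp_rw [sq_mul_exp_neg_sq_div_four_eq]
  rw [integral_const_mul,
    integral_abs_mul_comp_sq_div_four fun t => exp (-t) * t ^ (3 / 2 - 1 : ℝ),
    ← Gamma_eq_integral (by norm_num), Gamma_three_half]
  ring

lemma exp_neg_sq_div_four_mul_log_sq_eq (u : ℝ) :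
    exp (-u ^ 2 / 4) * log (u ^ 2) =
      1 / 2 * (|u| * ((u ^ 2 / 4) ^ (1 / 2 - 1 : ℝ) *
        (exp (-(u ^ 2 / 4)) * (log (u ^ 2 / 4) + 2 * log 2)))) := by
  rcases eq_or_ne u 0 with rfl | hu
  · simp
  · rw [← mul_assoc |u|, abs_mul_sq_div_four_rpow_neg_half hu, log_sq_eq_log_sq_div_four_add hu,
      neg_div]
    ring

lemma integrable_exp_neg_sq_div_four_mul_log_sq :
    Integrable fun u : ℝ => exp (-u ^ 2 / 4) * log (u ^ 2) := by
  simp_rw [exp_neg_sq_div_four_mul_log_sq_eq]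
  exact (integrable_abs_mul_comp_sq_div_four
    (integrableOn_rpow_mul_exp_neg_mul_log_add one_half_pos _)).const_mul _

lemma integral_exp_neg_sq_div_four_mul_log_sq :
    ∫ u : ℝ, exp (-u ^ 2 / 4) * log (u ^ 2) = -2 * √π * eulerMascheroniConstant := by
  simp_rw [exp_neg_sq_div_four_mul_log_sq_eq]
  rw [integral_const_mul, integral_abs_mul_comp_sq_div_four
      fun t => t ^ (1 / 2 - 1 : ℝ) * (exp (-t) * (log t + 2 * log 2)),
    integral_rpow_mul_exp_neg_mul_log_add one_half_pos, hasDerivAt_Gamma_one_half.deriv,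
    Gamma_one_half_eq]
  ring

lemma sq_mul_exp_neg_sq_div_four_mul_log_sq_eq (u : ℝ) :
    u ^ 2 * exp (-u ^ 2 / 4) * log (u ^ 2) =
      2 * (|u| * ((u ^ 2 / 4) ^ (3 / 2 - 1 : ℝ) *
        (exp (-(u ^ 2 / 4)) * (log (u ^ 2 / 4) + 2 * log 2)))) := by
  rcases eq_or_ne u 0 with rfl | hu
  · simp
  · rw [← mul_assoc |u|, abs_mul_sq_div_four_rpow_half, log_sq_eq_log_sq_div_four_add hu, neg_div]
    ring

lemma integrable_sq_mul_exp_neg_sq_div_four_mul_log_sq :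
    Integrable fun u : ℝ => u ^ 2 * exp (-u ^ 2 / 4) * log (u ^ 2) := by
  simp_rw [sq_mul_exp_neg_sq_div_four_mul_log_sq_eq]
  exact (integrable_abs_mul_comp_sq_div_four
    (integrableOn_rpow_mul_exp_neg_mul_log_add (by norm_num) _)).const_mul _

lemma integral_sq_mul_exp_neg_sq_div_four_mul_log_sq :
    ∫ u : ℝ, u ^ 2 * exp (-u ^ 2 / 4) * log (u ^ 2) =
      4 * √π * (2 - eulerMascheroniConstant) := by
  simp_rw [sq_mul_exp_neg_sq_div_four_mul_log_sq_eq]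
  rw [integral_const_mul, integral_abs_mul_comp_sq_div_four
      fun t => t ^ (3 / 2 - 1 : ℝ) * (exp (-t) * (log t + 2 * log 2)),
    integral_rpow_mul_exp_neg_mul_log_add (by norm_num), hasDerivAt_Gamma_three_half.deriv,
    Gamma_three_half]
  ring

end GaussianLog

/-- The two-dimensional Gaussian–logarithm integral evaluating to `32π(1 − γ)`. -/
theorem gaussian_log_integral_two_dim :
    (∫ w : ℝ × ℝ, (w.1 ^ 2 + w.2 ^ 2) * Real.exp (-(w.1 ^ 2 + w.2 ^ 2) / 4) *
        (Real.log (w.1 ^ 2) + Real.log (w.2 ^ 2))) =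
    32 * π * (1 - Real.eulerMascheroniConstant) := by
  let a : ℝ → ℝ := fun u => exp (-u ^ 2 / 4)
  let b : ℝ → ℝ := fun u => u ^ 2 * exp (-u ^ 2 / 4)
  let c : ℝ → ℝ := fun u => exp (-u ^ 2 / 4) * log (u ^ 2)
  let d : ℝ → ℝ := fun u => u ^ 2 * exp (-u ^ 2 / 4) * log (u ^ 2)
  have ha : Integrable a := integrable_exp_neg_sq_div_four
  have hb : Integrable b := integrable_sq_mul_exp_neg_sq_div_four
  have hc : Integrable c := integrable_exp_neg_sq_div_four_mul_log_sq
  have hd : Integrable d := integrable_sq_mul_exp_neg_sq_div_four_mul_log_sq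
  have hsplit : ∀ w : ℝ × ℝ, (w.1 ^ 2 + w.2 ^ 2) * exp (-(w.1 ^ 2 + w.2 ^ 2) / 4) *
      (log (w.1 ^ 2) + log (w.2 ^ 2)) =
      (d w.1 * a w.2 + a w.1 * d w.2) + (b w.1 * c w.2 + c w.1 * b w.2) := by
    intro w
    have hexp : exp (-(w.1 ^ 2 + w.2 ^ 2) / 4) = exp (-w.1 ^ 2 / 4) * exp (-w.2 ^ 2 / 4) := by
      rw [← exp_add]
      ring_nf
    rw [hexp]
    ring
  have hda := hd.mul_prod ha
  have had := ha.mul_prod hd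
  have hbc := hb.mul_prod hc
  have hcb := hc.mul_prod hb
  simp_rw [hsplit]
  rw [Measure.volume_eq_prod, integral_add (hda.fun_add had) (hbc.fun_add hcb), integral_add hda had,
    integral_add hbc hcb]
  simp only [integral_prod_mul]
  rw [show ∫ u, a u = _ from integral_exp_neg_sq_div_four,
    show ∫ u, b u = _ from integral_sq_mul_exp_neg_sq_div_four,
    show ∫ u, c u = _ from integral_exp_neg_sq_div_four_mul_log_sq,
    show ∫ u, d u = _ from integral_sq_mul_exp_neg_sq_div_four_mul_log_sq]
  linear_combination 32 * (1 - eulerMascheroniConstant) * sq_sqrt pi_pos.le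
end

section
/- Let Q denote the Minkowski quadratic form on ℝ⁴: Q(x) = −x₀² + x₁² + x₂² + x₃². For p ∈ ℝ⁴ and α > 0 define the Gaussian χ_p^α(x) = (α/π)² · exp(−α‖x − p‖²), where ‖·‖ is the Euclidean norm on ℝ⁴. Let p, q ∈ ℝ⁴ with Q(p − q) ≠ 0. Then the double integral ∫∫_{ℝ⁴×ℝ⁴} χ_p^α(x) · χ_q^α(y) · log|Q(x − y)| dx dy tends to log|Q(p − q)| as α → ∞. -/
open Real MeasureTheory Filter

/-- The Minkowski quadratic form on `ℝ⁴`. -/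
noncomputable def minkQ (x : EuclideanSpace ℝ (Fin 4)) : ℝ :=
  -(x 0) ^ 2 + (x 1) ^ 2 + (x 2) ^ 2 + (x 3) ^ 2

/-- The normalized Gaussian of width `1/√α` centered at `p`. -/
noncomputable def gaussChi (α : ℝ) (p x : EuclideanSpace ℝ (Fin 4)) : ℝ :=
  (α / π) ^ 2 * Real.exp (-α * ‖x - p‖ ^ 2)

/-- A weight times an integrable function of a coordinate `c` is integrable as soon as translating
the weight by a unit segment along which `c` moves at unit speed keeps it below an integrable
function. -/
lemma integrable_mul_comp_of_translate {G : Type*} [AddGroup G] [MeasurableSpace G]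
    [MeasurableAdd₂ G] {μ : Measure G} [SFinite μ] [μ.IsAddRightInvariant]
    {a : ℝ → G} {w w' c : G → ℝ} {k : ℝ → ℝ}
    (hw : Measurable w) (hw' : Measurable w') (hc : Measurable c) (hk : Measurable k)
    (hw0 : ∀ z, 0 ≤ w z) (hk0 : ∀ t, 0 ≤ k t) (hwi : Integrable w' μ) (hki : Integrable k)
    (hle : ∀ t ∈ Set.Icc (0 : ℝ) 1, ∀ z, w (z + a t) ≤ w' z)
    (hca : ∀ t z, c (z + a t) = c z + t) :
    Integrable (fun z => w z * k (c z)) μ := by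
  refine ⟨(hw.mul (hk.comp hc)).aestronglyMeasurable, ?_⟩
  rw [hasFiniteIntegral_iff_ofReal (ae_of_all _ fun z => mul_nonneg (hw0 z) (hk0 _))]
  calc ∫⁻ z, ENNReal.ofReal (w z * k (c z)) ∂μ
      = ∫⁻ _ in Set.Icc (0 : ℝ) 1, ∫⁻ z, ENNReal.ofReal (w z * k (c z)) ∂μ := by simp
    _ = ∫⁻ t in Set.Icc (0 : ℝ) 1,
          ∫⁻ z, ENNReal.ofReal (w (z + a t) * k (c (z + a t))) ∂μ := by
        refine lintegral_congr fun t => ?_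
        exact (lintegral_add_right_eq_self
          (fun z => ENNReal.ofReal (w z * k (c z))) (a t)).symm
    _ ≤ ∫⁻ t in Set.Icc (0 : ℝ) 1,
          ∫⁻ z, ENNReal.ofReal (w' z) * ENNReal.ofReal (k (c z + t)) ∂μ := by
        refine setLIntegral_mono' measurableSet_Icc fun t ht => lintegral_mono fun z => ?_
        rw [hca, ENNReal.ofReal_mul (hw0 _)]
        gcongr
        exact hle t ht z
    _ ≤ ∫⁻ t : ℝ, ∫⁻ z, ENNReal.ofReal (w' z) * ENNReal.ofReal (k (c z + t)) ∂μ :=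
        setLIntegral_le_lintegral _ _
    _ = ∫⁻ z, (∫⁻ t, ENNReal.ofReal (w' z) * ENNReal.ofReal (k (c z + t))) ∂μ := by
        refine lintegral_lintegral_swap (Measurable.aemeasurable ?_)
        unfold Function.uncurry
        fun_prop
    _ = ∫⁻ z, ENNReal.ofReal (w' z) * (∫⁻ t, ENNReal.ofReal (k t)) ∂μ := by
        refine lintegral_congr fun z => ?_
        rw [lintegral_const_mul _ (by fun_prop),
          lintegral_add_left_eq_self (fun t => ENNReal.ofReal (k t))]
    _ = (∫⁻ z, ENNReal.ofReal (w' z) ∂μ) * ∫⁻ t, ENNReal.ofReal (k t) :=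
        lintegral_mul_const _ (by fun_prop)
    _ < ⊤ := ENNReal.mul_lt_top hwi.lintegral_lt_top hki.lintegral_lt_top

/-- The part of `|log|` supported near its singularity. -/
noncomputable def logNear (s : ℝ) : ℝ := (Set.Icc (-1 : ℝ) 1).indicator (fun s => |log s|) s

lemma measurable_logNear : Measurable logNear :=
  (measurable_log.abs).indicator measurableSet_Icc

lemma logNear_nonneg (s : ℝ) : 0 ≤ logNear s :=
  Set.indicator_nonneg (fun _ _ => abs_nonneg _) s

lemma integrable_logNear : Integrable logNear := by
  have h : IntervalIntegrable log volume (-1) 1 := intervalIntegral.intervalIntegrable_log'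
  rw [intervalIntegrable_iff_integrableOn_Icc_of_le (by norm_num)] at h
  exact (integrable_indicator_iff measurableSet_Icc).2 h.abs

lemma abs_log_le_logNear_add (s : ℝ) : |log s| ≤ logNear s + |s| := by
  by_cases hs : s ∈ Set.Icc (-1 : ℝ) 1
  · simp [logNear, hs]
  · have h1 : 1 ≤ |s| := by
      by_contra! h
      exact hs ⟨(abs_lt.1 h).1.le, (abs_lt.1 h).2.le⟩
    have h2 := logNear_nonneg s
    rw [← log_abs, abs_of_nonneg (log_nonneg h1)]
    linarith [log_le_sub_one_of_pos (by linarith : 0 < |s|)]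

/-- The Euclidean length of the spatial part of a vector. -/
noncomputable def spatialNorm (x : EuclideanSpace ℝ (Fin 4)) : ℝ :=
  √((x 1) ^ 2 + (x 2) ^ 2 + (x 3) ^ 2)

lemma continuous_spatialNorm : Continuous spatialNorm := by
  unfold spatialNorm
  fun_prop

lemma continuous_minkQ : Continuous minkQ := by
  unfold minkQ
  fun_prop

lemma minkQ_eq_mul (x : EuclideanSpace ℝ (Fin 4)) :
    minkQ x = (x 0 + spatialNorm x) * (-(x 0 - spatialNorm x)) := by
  have : spatialNorm x ^ 2 = (x 1) ^ 2 + (x 2) ^ 2 + (x 3) ^ 2 := sq_sqrt (by positivity)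
  unfold minkQ
  linarith

lemma abs_zero_le_norm (x : EuclideanSpace ℝ (Fin 4)) : |x 0| ≤ ‖x‖ := by
  simpa using PiLp.norm_apply_le x 0

lemma spatialNorm_le_norm (x : EuclideanSpace ℝ (Fin 4)) : spatialNorm x ≤ ‖x‖ := by
  rw [EuclideanSpace.norm_eq, spatialNorm]
  apply sqrt_le_sqrt
  simp only [Fin.sum_univ_four, norm_eq_abs, sq_abs]
  nlinarith [sq_nonneg (x 0)]

lemma abs_log_minkQ_le (x : EuclideanSpace ℝ (Fin 4)) :
    |log (|minkQ x|)| ≤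
      logNear (x 0 + spatialNorm x) + logNear (x 0 - spatialNorm x) + 4 * ‖x‖ := by
  have h0 := abs_zero_le_norm x
  have h1 := spatialNorm_le_norm x
  have h2 : 0 ≤ spatialNorm x := sqrt_nonneg _
  have h3 := logNear_nonneg (x 0 + spatialNorm x)
  have h4 := logNear_nonneg (x 0 - spatialNorm x)
  have h5 := norm_nonneg x
  rw [log_abs, minkQ_eq_mul]
  by_cases ha : x 0 + spatialNorm x = 0
  · simp only [ha, zero_mul, log_zero, abs_zero] at *
    linarith
  by_cases hb : x 0 - spatialNorm x = 0
  · simp only [hb, neg_zero, mul_zero, log_zero, abs_zero] at *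
    linarith
  rw [log_mul ha (neg_ne_zero.2 hb), log_neg_eq_log]
  have i1 := abs_log_le_logNear_add (x 0 + spatialNorm x)
  have i2 := abs_log_le_logNear_add (x 0 - spatialNorm x)
  have i3 := abs_add_le (x 0) (spatialNorm x)
  have i4 := abs_sub (x 0) (spatialNorm x)
  have i5 := abs_add_le (log (x 0 + spatialNorm x)) (log (x 0 - spatialNorm x))
  rw [abs_of_nonneg h2] at i3 i4
  linarith

section Gaussian

variable {V : Type*} [NormedAddCommGroup V] [InnerProductSpace ℝ V] [FiniteDimensional ℝ V]
  [MeasurableSpace V] [BorelSpace V]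

lemma integral_exp_neg_mul_norm_sub_sq {b : ℝ} (hb : 0 < b) (p : V) :
    ∫ x : V, exp (-b * ‖x - p‖ ^ 2) = (π / b) ^ (Module.finrank ℝ V / 2 : ℝ) := by
  rw [integral_sub_right_eq_self (fun x : V => exp (-b * ‖x‖ ^ 2)) p]
  exact GaussianFourier.integral_rexp_neg_mul_sq_norm hb

lemma integrable_exp_neg_mul_norm_sub_sq {b : ℝ} (hb : 0 < b) (p : V) :
    Integrable fun x : V => exp (-b * ‖x - p‖ ^ 2) := by
  refine not_imp_comm.1 integral_undef ?_
  rw [integral_exp_neg_mul_norm_sub_sq hb]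
  positivity

end Gaussian

/-- The squared Euclidean distance from `(p, q)` in `ℝ⁴ × ℝ⁴`. -/
noncomputable def pairDistSq (p q : EuclideanSpace ℝ (Fin 4))
    (z : EuclideanSpace ℝ (Fin 4) × EuclideanSpace ℝ (Fin 4)) : ℝ :=
  ‖z.1 - p‖ ^ 2 + ‖z.2 - q‖ ^ 2

lemma continuous_pairDistSq (p q : EuclideanSpace ℝ (Fin 4)) : Continuous (pairDistSq p q) := by
  unfold pairDistSq
  fun_prop

lemma pairDistSq_nonneg (p q : EuclideanSpace ℝ (Fin 4))
    (z : EuclideanSpace ℝ (Fin 4) × EuclideanSpace ℝ (Fin 4)) : 0 ≤ pairDistSq p q z := by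
  unfold pairDistSq
  positivity

lemma integrable_exp_neg_mul_pairDistSq {b : ℝ} (hb : 0 < b) (p q : EuclideanSpace ℝ (Fin 4)) :
    Integrable fun z => exp (-b * pairDistSq p q z) := by
  simp only [pairDistSq, mul_add, exp_add]
  exact (integrable_exp_neg_mul_norm_sub_sq hb p).mul_prod
    (integrable_exp_neg_mul_norm_sub_sq hb q)

lemma integrable_exp_mul_logNear (p q : EuclideanSpace ℝ (Fin 4))
    {r : EuclideanSpace ℝ (Fin 4) → ℝ} (hr : Measurable r)
    (hrt : ∀ x (t : ℝ), r (x + t • EuclideanSpace.single 0 1) = r x) :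
    Integrable fun z : EuclideanSpace ℝ (Fin 4) × EuclideanSpace ℝ (Fin 4) =>
      exp (-pairDistSq p q z) * logNear ((z.1 - z.2) 0 + r (z.1 - z.2)) := by
  have hD := (continuous_pairDistSq p q).measurable
  rw [Measure.volume_eq_prod]
  refine integrable_mul_comp_of_translate
    (a := fun t : ℝ => (t • EuclideanSpace.single 0 1, 0))
    (w := fun z => exp (-pairDistSq p q z))
    (w' := fun z => exp 1 * exp (-(1 / 2) * pairDistSq p q z))
    (c := fun z => (z.1 - z.2) 0 + r (z.1 - z.2))
    (by fun_prop) (by fun_prop) ?_ measurable_logNear (fun _ => (exp_pos _).le) logNear_nonneg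
    ((integrable_exp_neg_mul_pairDistSq (by norm_num) p q).const_mul _) integrable_logNear ?_ ?_
  · have : Measurable fun x : EuclideanSpace ℝ (Fin 4) => x 0 := by fun_prop
    exact (this.comp (by fun_prop)).add (hr.comp (by fun_prop))
  · rintro t ⟨ht0, ht1⟩ ⟨x, y⟩
    rw [← exp_add, exp_le_exp]
    simp only [pairDistSq, Prod.mk_add_mk, add_zero]
    have h1 : ‖x - p‖ ≤ ‖x + t • EuclideanSpace.single 0 1 - p‖ + t := by
      calc ‖x - p‖ = ‖(x + t • EuclideanSpace.single 0 1 - p)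
            - t • (EuclideanSpace.single 0 1 : EuclideanSpace ℝ (Fin 4))‖ := by
            congr 1; abel
        _ ≤ _ := norm_sub_le _ _
        _ = _ := by simp [norm_smul, abs_of_nonneg ht0]
    set A := ‖x + t • EuclideanSpace.single 0 1 - p‖
    have h2 : ‖x - p‖ ^ 2 ≤ (A + t) ^ 2 := by gcongr
    nlinarith [sq_nonneg (A - t), sq_nonneg ‖y - q‖]
  · rintro t ⟨x, y⟩
    simp only [Prod.mk_add_mk, add_zero]
    rw [add_sub_right_comm, hrt]
    simp
    ring

lemma norm_sub_le_exp_pairDistSq (p q x y : EuclideanSpace ℝ (Fin 4)) :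
    ‖x - y‖ ≤ (2 + ‖p - q‖) * exp (1 / 2 * pairDistSq p q (x, y)) := by
  have h1 : ‖x - y‖ ≤ ‖x - p‖ + ‖p - q‖ + ‖y - q‖ := by
    calc ‖x - y‖ = ‖(x - p) + (p - q) - (y - q)‖ := by congr 1; abel
      _ ≤ ‖(x - p) + (p - q)‖ + ‖y - q‖ := norm_sub_le _ _
      _ ≤ _ := by gcongr; exact norm_add_le _ _
  have h2 := add_one_le_exp (1 / 2 * pairDistSq p q (x, y))
  have h3 : pairDistSq p q (x, y) = ‖x - p‖ ^ 2 + ‖y - q‖ ^ 2 := rfl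
  nlinarith [norm_nonneg (p - q), sq_nonneg (‖x - p‖ - 1), sq_nonneg (‖y - q‖ - 1),
    mul_nonneg (norm_nonneg (p - q)) (pairDistSq_nonneg p q (x, y)), norm_nonneg (x - p),
    mul_le_mul_of_nonneg_left h2 (by positivity : 0 ≤ 2 + ‖p - q‖)]

lemma measurable_log_abs_minkQ_sub :
    Measurable fun z : EuclideanSpace ℝ (Fin 4) × EuclideanSpace ℝ (Fin 4) =>
      log |minkQ (z.1 - z.2)| := by
  have := continuous_minkQ.measurable
  fun_prop

lemma integrable_exp_mul_log_abs_minkQ (p q : EuclideanSpace ℝ (Fin 4)) :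
    Integrable fun z : EuclideanSpace ℝ (Fin 4) × EuclideanSpace ℝ (Fin 4) =>
      exp (-pairDistSq p q z) * log |minkQ (z.1 - z.2)| := by
  have hs : ∀ x (t : ℝ), spatialNorm (x + t • EuclideanSpace.single 0 1) = spatialNorm x := by
    intro x t
    simp [spatialNorm]
  have hm := continuous_spatialNorm.measurable
  have i1 := integrable_exp_mul_logNear p q hm hs
  have i2 := integrable_exp_mul_logNear p q hm.neg (fun x t => by simp [hs])
  have i3 := (integrable_exp_neg_mul_pairDistSq (b := 1 / 2) (by norm_num) p q).const_mul
    (4 * (2 + ‖p - q‖))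
  have hD := (continuous_pairDistSq p q).measurable
  refine ((i1.add i2).add i3).mono'
    (Measurable.aestronglyMeasurable (Measurable.mul (by fun_prop) measurable_log_abs_minkQ_sub))
    (ae_of_all _ ?_)
  rintro ⟨x, y⟩
  have h1 := abs_log_minkQ_le (x - y)
  have h2 := norm_sub_le_exp_pairDistSq p q x y
  have h3 : exp (-(1 / 2) * pairDistSq p q (x, y)) =
      exp (-pairDistSq p q (x, y)) * exp (1 / 2 * pairDistSq p q (x, y)) := by
    rw [← exp_add]
    ring_nf
  simp only [Pi.add_apply, Pi.neg_apply, norm_mul, norm_eq_abs, abs_exp, h3, ← sub_eq_add_neg]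
  have h4 := mul_le_mul_of_nonneg_left (h1.trans (add_le_add_right
    (mul_le_mul_of_nonneg_left h2 (by norm_num : (0 : ℝ) ≤ 4)) _))
    (exp_pos (-pairDistSq p q (x, y))).le
  linarith

lemma integral_gaussChi {α : ℝ} (hα : 0 < α) (p : EuclideanSpace ℝ (Fin 4)) :
    ∫ x, gaussChi α p x = 1 := by
  simp only [gaussChi]
  rw [integral_const_mul, integral_exp_neg_mul_norm_sub_sq hα, finrank_euclideanSpace_fin]
  have : ((4 : ℕ) / 2 : ℝ) = (2 : ℕ) := by norm_num
  rw [this, rpow_natCast]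
  field_simp

/-- The product of two Gaussians, relative to the density `exp (-pairDistSq p q)`. -/
noncomputable def relGauss (p q : EuclideanSpace ℝ (Fin 4)) (α : ℝ)
    (z : EuclideanSpace ℝ (Fin 4) × EuclideanSpace ℝ (Fin 4)) : ℝ :=
  (α / π) ^ 4 * exp (-(α - 1) * pairDistSq p q z)

lemma exp_mul_relGauss (p q : EuclideanSpace ℝ (Fin 4)) (α : ℝ)
    (z : EuclideanSpace ℝ (Fin 4) × EuclideanSpace ℝ (Fin 4)) :
    exp (-pairDistSq p q z) * relGauss p q α z = gaussChi α p z.1 * gaussChi α q z.2 := by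
  have : exp (-pairDistSq p q z) * exp (-(α - 1) * pairDistSq p q z) =
      exp (-α * ‖z.1 - p‖ ^ 2) * exp (-α * ‖z.2 - q‖ ^ 2) := by
    rw [← exp_add, ← exp_add, pairDistSq]
    ring_nf
  unfold relGauss gaussChi
  linear_combination (α / π) ^ 4 * this

lemma measurable_relGauss (p q : EuclideanSpace ℝ (Fin 4)) (α : ℝ) :
    Measurable (relGauss p q α) := by
  have hD := (continuous_pairDistSq p q).measurable
  unfold relGauss
  fun_prop

lemma tendsto_pow_mul_exp_neg_sub_one_mul {δ : ℝ} (hδ : 0 < δ) :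
    Tendsto (fun α : ℝ => (α / π) ^ 4 * exp (-(α - 1) * δ)) atTop (nhds 0) := by
  have h := (tendsto_pow_mul_exp_neg_atTop_nhds_zero 4).comp
    (tendsto_id.atTop_mul_const hδ : Tendsto (fun α : ℝ => α * δ) atTop atTop)
  have h' := h.const_mul ((1 / (π * δ)) ^ 4 * exp δ)
  rw [mul_zero] at h'
  refine h'.congr fun α => ?_
  have : exp (-(α - 1) * δ) = exp δ * exp (-(α * δ)) := by
    rw [← exp_add]
    ring_nf
  rw [this]
  simp only [Function.comp_apply]
  field_simp

lemma tendstoUniformlyOn_relGauss (p q : EuclideanSpace ℝ (Fin 4))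
    {u : Set (EuclideanSpace ℝ (Fin 4) × EuclideanSpace ℝ (Fin 4))} (hu : IsOpen u)
    (hpq : (p, q) ∈ u) : TendstoUniformlyOn (relGauss p q) 0 atTop uᶜ := by
  obtain ⟨ε, hε, hball⟩ := Metric.isOpen_iff.1 hu _ hpq
  rw [Metric.tendstoUniformlyOn_iff]
  intro η hη
  filter_upwards [(tendsto_pow_mul_exp_neg_sub_one_mul (sq_pos_of_pos hε)).eventually_lt_const hη,
    eventually_ge_atTop 1] with α hα hα1 z hz
  have hz' : ε ≤ dist z (p, q) := by
    by_contra! h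
    exact hz (hball h)
  have hD : ε ^ 2 ≤ pairDistSq p q z := by
    rw [Prod.dist_eq, dist_eq_norm, dist_eq_norm, le_max_iff] at hz'
    unfold pairDistSq
    rcases hz' with h | h
    · nlinarith [sq_nonneg ‖z.2 - q‖]
    · nlinarith [sq_nonneg ‖z.1 - p‖]
  rw [Pi.zero_apply, dist_zero_left, norm_eq_abs, relGauss, abs_of_nonneg (by positivity)]
  refine lt_of_le_of_lt ?_ hα
  gcongr ?_ * exp ?_
  nlinarith

/-- Cross-term localization limit: as `α → ∞`, the Gaussian-smeared logarithmic kernel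
converges to `log |Q(p − q)|`. -/
theorem gaussian_localization_cross_term
    (p q : EuclideanSpace ℝ (Fin 4)) (hpq : minkQ (p - q) ≠ 0) :
    Tendsto (fun α : ℝ =>
        ∫ x : EuclideanSpace ℝ (Fin 4), ∫ y : EuclideanSpace ℝ (Fin 4),
          gaussChi α p x * gaussChi α q y * Real.log |minkQ (x - y)|)
      atTop (nhds (Real.log |minkQ (p - q)|)) := by
  set ρ : EuclideanSpace ℝ (Fin 4) × EuclideanSpace ℝ (Fin 4) → ENNReal :=
    fun z => ENNReal.ofReal (exp (-pairDistSq p q z)) with hρ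
  have hD := (continuous_pairDistSq p q).measurable
  have hρm : Measurable ρ := by fun_prop
  have hρt : ∀ᵐ z, ρ z < ⊤ := ae_of_all _ fun z => ENNReal.ofReal_lt_top
  have hρr : ∀ z, (ρ z).toReal = exp (-pairDistSq p q z) := fun z =>
    ENNReal.toReal_ofReal (exp_pos _).le
  have hfin : volume.withDensity ρ Set.univ ≠ ⊤ := by
    have := (integrable_exp_neg_mul_pairDistSq one_pos p q).lintegral_lt_top
    simp only [neg_mul, one_mul] at this
    simpa [hρ] using this.ne
  have hint : Integrable (fun z : EuclideanSpace ℝ (Fin 4) × EuclideanSpace ℝ (Fin 4) =>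
      log |minkQ (z.1 - z.2)|) (volume.withDensity ρ) := by
    rw [integrable_withDensity_iff_integrable_smul' hρm hρt]
    simpa only [hρr, smul_eq_mul] using integrable_exp_mul_log_abs_minkQ p q
  have hcont : Tendsto (fun z : EuclideanSpace ℝ (Fin 4) × EuclideanSpace ℝ (Fin 4) =>
      log |minkQ (z.1 - z.2)|) (nhds (p, q)) (nhds (log |minkQ (p - q)|)) := by
    have h : Continuous fun z : EuclideanSpace ℝ (Fin 4) × EuclideanSpace ℝ (Fin 4) =>
        |minkQ (z.1 - z.2)| := by
      have := continuous_minkQ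
      fun_prop
    exact (h.tendsto (p, q)).log (abs_ne_zero.2 hpq)
  have hone : Tendsto (fun α => ∫ z in Set.univ, relGauss p q α z ∂(volume.withDensity ρ))
      atTop (nhds 1) := by
    refine tendsto_const_nhds.congr' ?_
    filter_upwards [eventually_gt_atTop 0] with α hα
    rw [setIntegral_univ, integral_withDensity_eq_integral_toReal_smul hρm hρt]
    simp only [hρr, smul_eq_mul, exp_mul_relGauss]
    rw [Measure.volume_eq_prod, integral_prod_mul, integral_gaussChi hα, integral_gaussChi hα,
      one_mul]
  have key := tendsto_integral_peak_smul_of_integrable_of_tendsto (φ := relGauss p q)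
    MeasurableSet.univ univ_mem hfin
    (Eventually.of_forall fun α z => by unfold relGauss; positivity)
    (fun u hu h => tendstoUniformlyOn_relGauss p q hu h) hone
    (Eventually.of_forall fun α => (measurable_relGauss p q α).aestronglyMeasurable) hint hcont
  refine key.congr' ?_
  filter_upwards [eventually_ge_atTop 1] with α hα
  have hbdd : Integrable (fun z => relGauss p q α z • log |minkQ (z.1 - z.2)|)
      (volume.withDensity ρ) := by
    refine hint.bdd_mul (c := (α / π) ^ 4) (measurable_relGauss p q α).aestronglyMeasurable
      (ae_of_all _ fun z => ?_)
    rw [norm_eq_abs, relGauss, abs_of_nonneg (by positivity)]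
    refine mul_le_of_le_one_right (by positivity) (exp_le_one_iff.2 ?_)
    nlinarith [mul_nonneg (sub_nonneg.2 hα) (pairDistSq_nonneg p q z)]
  rw [integrable_withDensity_iff_integrable_smul' hρm hρt] at hbdd
  rw [integral_withDensity_eq_integral_toReal_smul hρm hρt]
  simp only [hρr, smul_eq_mul, ← mul_assoc, exp_mul_relGauss] at hbdd ⊢
  rw [Measure.volume_eq_prod] at hbdd ⊢
  exact integral_prod _ hbdd
end

section
/- Let Q denote the Minkowski quadratic form on ℝ⁴: Q(x) = −x₀² + x₁² + x₂² + x₃². For p ∈ ℝ⁴ and α > 0 define χ_p^α(x) = (α/π)² · exp(−α‖x − p‖²), where ‖·‖ is the Euclidean norm on ℝ⁴. Then for every p ∈ ℝ⁴ and every α > 0, ∫∫_{ℝ⁴×ℝ⁴} χ_p^α(x) · χ_p^α(y) · log(α·|Q(x − y)|) dx dy = (1/π⁴) · ∫∫_{ℝ⁴×ℝ⁴} exp(−2‖z‖² − ‖y‖²/2) · log|Q(y)| dy dz; in particular the left-hand side is independent of α and of p. -/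
open Real MeasureTheory Filter

theorem abs_log_le_two_mul_rpow_add {x : ℝ} (hx : 0 < x) :
    |Real.log x| ≤ 2 * (x ^ (1 / 2 : ℝ) + x ^ (-(1 / 2) : ℝ)) := by
  have h1 := Real.log_le_rpow_div hx.le (by norm_num : (0 : ℝ) < 1 / 2)
  have h2 := Real.log_le_rpow_div (inv_pos.2 hx).le (by norm_num : (0 : ℝ) < 1 / 2)
  rw [Real.log_inv, Real.inv_rpow hx.le, ← Real.rpow_neg hx.le] at h2
  have h3 := Real.rpow_pos_of_pos hx (1 / 2)
  have h4 := Real.rpow_pos_of_pos hx (-(1 / 2))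
  rw [abs_le]
  constructor <;> linarith

theorem integrable_exp_neg_mul_sq_mul_abs_log {c : ℝ} (hc : 0 < c) :
    Integrable fun t : ℝ => Real.exp (-c * t ^ 2) * |Real.log t| := by
  set k : ℝ → ℝ := fun x =>
    2 * (x ^ (1 / 2 : ℝ) * Real.exp (-c * x ^ 2) + x ^ (-(1 / 2) : ℝ) * Real.exp (-c * x ^ 2))
    with hk
  have hki : Integrable k :=
    ((integrable_rpow_mul_exp_neg_mul_sq hc (by norm_num)).add
      (integrable_rpow_mul_exp_neg_mul_sq hc (by norm_num))).const_mul 2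
  have key : ∀ x : ℝ, 0 < x → Real.exp (-c * x ^ 2) * |Real.log x| ≤ ‖k x‖ := by
    intro x hx
    refine le_trans ?_ (le_abs_self _)
    have := mul_le_mul_of_nonneg_left (abs_log_le_two_mul_rpow_add hx)
      (Real.exp_pos (-c * x ^ 2)).le
    simp only [hk]
    linarith
  refine (hki.norm.add hki.comp_neg.norm).mono' ?_ (ae_of_all _ fun x => ?_)
  · exact Measurable.aestronglyMeasurable (by fun_prop)
  · rw [Real.norm_of_nonneg (by positivity)]
    rcases lt_trichotomy x 0 with h | h | h
    · have := key (-x) (by linarith)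
      rw [Real.log_neg_eq_log, neg_sq] at this
      exact this.trans (le_add_of_nonneg_left (norm_nonneg _))
    · subst h
      simp only [Real.log_zero, abs_zero, mul_zero]
      exact add_nonneg (norm_nonneg _) (norm_nonneg _)
    · exact (key x h).trans (le_add_of_nonneg_right (norm_nonneg _))

theorem measurePreserving_prod_shear {α G : Type*} [MeasurableSpace α] [MeasurableSpace G]
    [AddGroup G] [MeasurableAdd₂ G] (μ : Measure α) (ν : Measure G) [SFinite μ] [SFinite ν]
    [ν.IsAddRightInvariant] {b : α → G} (hb : Measurable b) :
    MeasurePreserving (fun q : α × G => (q.1, q.2 + b q.1)) (μ.prod ν) (μ.prod ν) :=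
  (MeasurePreserving.id μ).skew_product (g := fun a x => x + b a)
    (measurable_snd.add (hb.comp measurable_fst))
    (ae_of_all _ fun a => map_add_right_eq_self ν (b a))

theorem integrable_exp_neg_mul_sum_sq {ι : Type*} [Fintype ι] {c : ℝ} (hc : 0 < c) :
    Integrable fun v : ι → ℝ => Real.exp (-c * ∑ i, v i ^ 2) := by
  have := Integrable.fintype_prod (ι := ι) (f := fun _ => fun t : ℝ => Real.exp (-c * t ^ 2))
    (μ := fun _ => volume) (fun _ => integrable_exp_neg_mul_sq hc)
  simp only [Finset.mul_sum, Real.exp_sum]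
  exact this

theorem abs_log_sq_sub_sq_le (t b : ℝ) :
    |Real.log (b ^ 2 - t ^ 2)| ≤ |Real.log (t - b)| + |Real.log (t + b)| := by
  by_cases h1 : t - b = 0
  · have : b ^ 2 - t ^ 2 = 0 := by linear_combination -(t + b) * h1
    rw [this, Real.log_zero, abs_zero]
    positivity
  by_cases h2 : t + b = 0
  · have : b ^ 2 - t ^ 2 = 0 := by linear_combination -(t - b) * h2
    rw [this, Real.log_zero, abs_zero]
    positivity
  have : b ^ 2 - t ^ 2 = -((t - b) * (t + b)) := by ring
  rw [this, Real.log_neg_eq_log, Real.log_mul h1 h2]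
  exact abs_add_le _ _

theorem measurable_minkQ : Measurable minkQ := by
  unfold minkQ
  fun_prop

theorem integrable_exp_neg_norm_sq_mul_log_minkQ :
    Integrable fun y : EuclideanSpace ℝ (Fin 4) =>
      Real.exp (-‖y‖ ^ 2 / 2) * Real.log |minkQ y| := by
  have hprod := (integrable_exp_neg_mul_sum_sq (ι := Fin 3) (c := 1 / 6) (by norm_num)).mul_prod
    (integrable_exp_neg_mul_sq_mul_abs_log (c := 1 / 6) (by norm_num))
  have hb : Measurable fun v : Fin 3 → ℝ => √(∑ i, v i ^ 2) := by fun_prop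
  have hplus := (measurePreserving_prod_shear volume volume hb).integrable_comp_of_integrable hprod
  have hminus :=
    (measurePreserving_prod_shear volume volume hb.neg).integrable_comp_of_integrable hprod
  have he : MeasurePreserving
      (fun y : EuclideanSpace ℝ (Fin 4) => ((fun i : Fin 3 => y i.succ), y 0))
      volume ((volume : Measure (Fin 3 → ℝ)).prod (volume : Measure ℝ)) :=
    (Measure.measurePreserving_swap.comp
      (volume_preserving_piFinSuccAbove (fun _ : Fin 4 => ℝ) 0)).comp
        (PiLp.volume_preserving_ofLp (Fin 4))
  refine (he.integrable_comp_of_integrable (hminus.add hplus)).mono' ?_ (ae_of_all _ fun y => ?_)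
  · have := measurable_minkQ
    exact Measurable.aestronglyMeasurable (by fun_prop)
  · have hs : 0 ≤ ∑ i : Fin 3, y i.succ ^ 2 := by positivity
    have hQ : minkQ y = √(∑ i : Fin 3, y i.succ ^ 2) ^ 2 - y 0 ^ 2 := by
      rw [Real.sq_sqrt hs, minkQ, Fin.sum_univ_three]
      change _ = y 1 ^ 2 + y 2 ^ 2 + y 3 ^ 2 - y 0 ^ 2
      ring
    have hn : ‖y‖ ^ 2 = √(∑ i : Fin 3, y i.succ ^ 2) ^ 2 + y 0 ^ 2 := by
      rw [Real.sq_sqrt hs, EuclideanSpace.real_norm_sq_eq, Fin.sum_univ_succ, add_comm]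
    have hS : ∑ i : Fin 3, y i.succ ^ 2 = √(∑ i : Fin 3, y i.succ ^ 2) ^ 2 :=
      (Real.sq_sqrt hs).symm
    simp only [Function.comp_apply, Pi.add_apply, Pi.neg_apply]
    rw [hn, hQ, Real.log_abs, norm_mul, Real.norm_of_nonneg (Real.exp_pos _).le, Real.norm_eq_abs]
    generalize √(∑ i : Fin 3, y i.succ ^ 2) = b at hS ⊢
    rw [hS, ← sub_eq_add_neg, ← mul_assoc, ← mul_assoc, ← Real.exp_add, ← Real.exp_add]
    generalize y 0 = t
    refine (mul_le_mul_of_nonneg_left (abs_log_sq_sub_sq_le t b) (Real.exp_pos _).le).trans ?_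
    rw [mul_add]
    gcongr
    · nlinarith [sq_nonneg (t + b), sq_nonneg t]
    · nlinarith [sq_nonneg (t - b), sq_nonneg t]

theorem integrable_exp_neg_mul_norm_sq {V : Type*} [NormedAddCommGroup V] [InnerProductSpace ℝ V]
    [FiniteDimensional ℝ V] [MeasurableSpace V] [BorelSpace V] {c : ℝ} (hc : 0 < c) :
    Integrable fun v : V => Real.exp (-c * ‖v‖ ^ 2) := by
  have h := (GaussianFourier.integrable_cexp_neg_mul_sq_norm_add (V := V) (b := (c : ℂ))
    (by simpa using hc) 0 0).norm
  refine h.congr (ae_of_all _ fun v => ?_)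
  simp [Complex.norm_exp, ← Complex.ofReal_pow]

theorem integrable_gaussian_mul_log_minkQ :
    Integrable (Function.uncurry fun y z : EuclideanSpace ℝ (Fin 4) =>
      Real.exp (-2 * ‖z‖ ^ 2 - ‖y‖ ^ 2 / 2) * Real.log |minkQ y|) (volume.prod volume) := by
  refine (integrable_exp_neg_norm_sq_mul_log_minkQ.mul_prod
    (integrable_exp_neg_mul_norm_sq (V := EuclideanSpace ℝ (Fin 4)) two_pos)).congr
      (ae_of_all _ fun q => ?_)
  simp only [Function.uncurry]
  rw [mul_right_comm, ← Real.exp_add]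
  ring_nf

theorem integral_integral_gaussian_sheared :
    (∫ x : EuclideanSpace ℝ (Fin 4), ∫ w : EuclideanSpace ℝ (Fin 4),
      Real.exp (-‖x‖ ^ 2 - ‖x - w‖ ^ 2) * Real.log |minkQ w|) =
    ∫ z : EuclideanSpace ℝ (Fin 4), ∫ y : EuclideanSpace ℝ (Fin 4),
      Real.exp (-2 * ‖z‖ ^ 2 - ‖y‖ ^ 2 / 2) * Real.log |minkQ y| := by
  have hid : ∀ w x : EuclideanSpace ℝ (Fin 4), Real.exp (-‖x‖ ^ 2 - ‖x - w‖ ^ 2)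
      = Real.exp (-2 * ‖x + -((1 / 2 : ℝ) • w)‖ ^ 2 - ‖w‖ ^ 2 / 2) := by
    intro w x
    rw [← sub_eq_add_neg, norm_sub_sq_real, norm_sub_sq_real, inner_smul_right, norm_smul,
      Real.norm_of_nonneg (by norm_num)]
    ring_nf
  have hb : Measurable fun w : EuclideanSpace ℝ (Fin 4) => -((1 / 2 : ℝ) • w) := by fun_prop
  have hi : Integrable (Function.uncurry fun w x : EuclideanSpace ℝ (Fin 4) =>
      Real.exp (-2 * ‖x + -((1 / 2 : ℝ) • w)‖ ^ 2 - ‖w‖ ^ 2 / 2) * Real.log |minkQ w|)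
      (volume.prod volume) :=
    (measurePreserving_prod_shear volume volume hb).integrable_comp_of_integrable
      integrable_gaussian_mul_log_minkQ
  simp only [hid]
  rw [← integral_integral_swap hi, ← integral_integral_swap integrable_gaussian_mul_log_minkQ]
  congr 1 with w
  exact integral_add_right_eq_self (fun z : EuclideanSpace ℝ (Fin 4) =>
    Real.exp (-2 * ‖z‖ ^ 2 - ‖w‖ ^ 2 / 2) * Real.log |minkQ w|) (-((1 / 2 : ℝ) • w))

theorem minkQ_smul (r : ℝ) (x : EuclideanSpace ℝ (Fin 4)) : minkQ (r • x) = r ^ 2 * minkQ x := by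
  simp only [minkQ, PiLp.smul_apply, smul_eq_mul]
  ring

/-- Self-term scaling identity: the Gaussian-smeared rescaled logarithmic kernel is
independent of `α` and of the center `p`, and equals an explicit Gaussian integral. -/
theorem gaussian_self_term_scaling
    (p : EuclideanSpace ℝ (Fin 4)) (α : ℝ) (hα : 0 < α) :
    (∫ x : EuclideanSpace ℝ (Fin 4), ∫ y : EuclideanSpace ℝ (Fin 4),
        gaussChi α p x * gaussChi α p y * Real.log (α * |minkQ (x - y)|)) =
    (1 / π ^ 4) * ∫ z : EuclideanSpace ℝ (Fin 4), ∫ y : EuclideanSpace ℝ (Fin 4),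
        Real.exp (-2 * ‖z‖ ^ 2 - ‖y‖ ^ 2 / 2) * Real.log |minkQ y| := by
  have hs : √α ^ 2 = α := Real.sq_sqrt hα.le
  set g : EuclideanSpace ℝ (Fin 4) → EuclideanSpace ℝ (Fin 4) → ℝ := fun x w =>
    Real.exp (-‖x‖ ^ 2 - ‖x - w‖ ^ 2) * Real.log |minkQ w| with hg
  have hpt : ∀ x w : EuclideanSpace ℝ (Fin 4),
      gaussChi α p (x + p) * gaussChi α p (x + p - w) *
        Real.log (α * |minkQ (x + p - (x + p - w))|) =
      (α / π) ^ 4 * g (√α • x) (√α • w) := by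
    intro x w
    have h1 : x + p - w - p = x - w := by abel
    simp only [hg, gaussChi]
    rw [h1, add_sub_cancel_right, sub_sub_cancel, ← smul_sub, norm_smul, norm_smul, minkQ_smul,
      mul_pow, mul_pow, Real.norm_of_nonneg (Real.sqrt_nonneg α), hs, abs_mul, abs_of_pos hα,
      sub_eq_add_neg (-(α * ‖x‖ ^ 2)), Real.exp_add, neg_mul, neg_mul]
    ring
  have hscale : ∀ f : EuclideanSpace ℝ (Fin 4) → ℝ, ∫ x, f (√α • x) = (α ^ 2)⁻¹ * ∫ x, f x := by
    intro f
    have h4 : √α ^ 4 = α ^ 2 := by rw [← hs]; ring_nf; rw [hs]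
    rw [Measure.integral_comp_smul, finrank_euclideanSpace_fin, h4, abs_of_nonneg (by positivity),
      smul_eq_mul]
  rw [← integral_integral_gaussian_sheared, ← integral_add_right_eq_self _ p]
  have hinner : ∀ x : EuclideanSpace ℝ (Fin 4),
      (∫ y, gaussChi α p (x + p) * gaussChi α p y * Real.log (α * |minkQ (x + p - y)|)) =
        (α / π) ^ 4 * ((α ^ 2)⁻¹ * ∫ w, g (√α • x) w) := by
    intro x
    rw [← integral_sub_left_eq_self _ volume (x + p)]
    simp only [hpt]
    rw [integral_const_mul, hscale (g (√α • x))]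
  simp only [hinner]
  rw [integral_const_mul, integral_const_mul, hscale fun x => ∫ w, g x w]
  field_simp
  simp only [hg]
end
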